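/- Let G be a finite simple graph on vertex set V with edge set E, let S ⊆ V, and let H₁ be the graph on V with edge set E ∪ {xy : x, y ∈ V ∖ S, x ≠ y}. Then box(G) ≤ box(H₁) + box(G[V ∖ S]), where G[V ∖ S] is the induced subgraph of G on V ∖ S. -/

import Mathlib

/-- A finite simple graph `H` is an interval graph if there is an assignment of
real intervals `[l v, r v]` (with `l v ≤ r v`) to the vertices such that distinct
vertices are adjacent iff their intervals intersect. -/
def IsIntervalGraph {V : Type*} (H : SimpleGraph V) : Prop :=
  ∃ l r : V → ℝ, (∀ v, l v ≤ r v) ∧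
    ∀ u v : V, u ≠ v →
      (H.Adj u v ↔ (Set.Icc (l u) (r u) ∩ Set.Icc (l v) (r v)).Nonempty)

/-- The boxicity of `G` : the least `k` such that `G` is the edge-intersection of
`k` interval graphs on the same vertex set. -/
noncomputable def boxicity {V : Type*} (G : SimpleGraph V) : ℕ :=
  sInf {k | ∃ I : Fin k → SimpleGraph V,
    (∀ i, IsIntervalGraph (I i)) ∧ ∀ u v : V, G.Adj u v ↔ ∀ i, (I i).Adj u v}

/-- A family of interval graphs indexed by any finite type bounds the boxicity. -/
theorem boxicity_le_card {V ι : Type*} [Fintype ι] (G : SimpleGraph V) (I : ι → SimpleGraph V)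
    (hI : ∀ i, IsIntervalGraph (I i)) (hG : ∀ u v : V, G.Adj u v ↔ ∀ i, (I i).Adj u v) :
    boxicity G ≤ Fintype.card ι := by
  refine Nat.sInf_le ⟨I ∘ (Fintype.equivFin ι).symm, fun i => hI _, fun u v => ?_⟩
  rw [hG, ← (Fintype.equivFin ι).symm.forall_congr_right]
  rfl

/-- The graph in which the vertex `a` keeps its neighbourhood in `G` and all other pairs of
distinct vertices are adjacent. -/
def SimpleGraph.completeAwayFrom {V : Type*} (G : SimpleGraph V) (a : V) : SimpleGraph V where
  Adj u v := u ≠ v ∧ (u = a ∨ v = a → G.Adj u v)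
  symm := ⟨fun _ _ huv => ⟨huv.1.symm, fun hvu => (huv.2 hvu.symm).symm⟩⟩
  loopless := ⟨fun _ hu => hu.1 rfl⟩

theorem isIntervalGraph_completeAwayFrom {V : Type*} (G : SimpleGraph V) (a : V) :
    IsIntervalGraph (G.completeAwayFrom a) := by
  classical
  refine ⟨fun v => if v = a ∨ G.Adj a v then 0 else 1, fun v => if v = a then 0 else 1,
    fun v => ?_, fun u v huv => ?_⟩
  · by_cases hv : v = a <;> by_cases hav : G.Adj a v <;> simp [hv, hav]
  · rw [Set.Icc_inter_Icc, Set.nonempty_Icc]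
    by_cases hu : u = a
    · subst hu
      by_cases hG : G.Adj u v <;> simp [SimpleGraph.completeAwayFrom, huv, huv.symm, hG]
    · by_cases hv : v = a
      · subst hv
        by_cases hG : G.Adj v u <;>
          simp [SimpleGraph.completeAwayFrom, huv, hG, G.adj_comm u v]
      · by_cases hau : G.Adj a u <;> by_cases hav : G.Adj a v <;>
          simp [SimpleGraph.completeAwayFrom, huv, hu, hv, hau, hav]

/-- The boxicity of a finite graph is attained. -/
theorem exists_isIntervalGraph_fin_boxicity {V : Type*} [Finite V] (G : SimpleGraph V) :
    ∃ I : Fin (boxicity G) → SimpleGraph V,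
      (∀ i, IsIntervalGraph (I i)) ∧ ∀ u v : V, G.Adj u v ↔ ∀ i, (I i).Adj u v := by
  cases nonempty_fintype V
  refine Nat.sInf_mem (s := {k | ∃ I : Fin k → SimpleGraph V,
    (∀ i, IsIntervalGraph (I i)) ∧ ∀ u v : V, G.Adj u v ↔ ∀ i, (I i).Adj u v})
    ⟨Fintype.card V, fun i => G.completeAwayFrom ((Fintype.equivFin V).symm i),
      fun i => isIntervalGraph_completeAwayFrom G _, fun u v => ?_⟩
  refine ⟨fun huv i => ⟨huv.ne, fun _ => huv⟩, fun huv => ?_⟩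
  simpa using (huv (Fintype.equivFin V u)).2

/-- The extension of a graph on `T` to the ambient type in which the vertices outside `T` are
universal. -/
def SimpleGraph.extendUniversal {V : Type*} {T : Set V} (J : SimpleGraph T) :
    SimpleGraph V where
  Adj u v := u ≠ v ∧ ∀ (hu : u ∈ T) (hv : v ∈ T), J.Adj ⟨u, hu⟩ ⟨v, hv⟩
  symm := ⟨fun _ _ huv => ⟨huv.1.symm, fun hv hu => (huv.2 hu hv).symm⟩⟩
  loopless := ⟨fun _ hu => hu.1 rfl⟩

theorem IsIntervalGraph.extendUniversal {V : Type*} {T : Set V} [Finite T] {J : SimpleGraph T}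
    (hJ : IsIntervalGraph J) : IsIntervalGraph J.extendUniversal := by
  classical
  obtain ⟨l, r, hlr, hadj⟩ := hJ
  obtain ⟨m, hm⟩ := Finite.exists_ge l
  obtain ⟨M, hM⟩ := Finite.exists_le r
  refine ⟨fun v => if hv : v ∈ T then l ⟨v, hv⟩ else min m M,
    fun v => if hv : v ∈ T then r ⟨v, hv⟩ else max m M, fun v => ?_, fun u v huv => ?_⟩
  · by_cases hv : v ∈ T <;> simp [hv, hlr]
  · by_cases hu : u ∈ T <;> by_cases hv : v ∈ T
    · simpa [SimpleGraph.extendUniversal, huv, hu, hv] using hadj ⟨u, hu⟩ ⟨v, hv⟩ (by simpa)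
    · have h₁ := hlr ⟨u, hu⟩
      have h₂ := hm ⟨u, hu⟩
      have h₃ := hM ⟨u, hu⟩
      simpa [SimpleGraph.extendUniversal, huv, hu, hv, Set.Icc_inter_Icc, h₁] using
        ⟨Or.inl (h₂.trans h₁), Or.inr (h₁.trans h₃)⟩
    · have h₁ := hlr ⟨v, hv⟩
      have h₂ := hm ⟨v, hv⟩
      have h₃ := hM ⟨v, hv⟩
      simpa [SimpleGraph.extendUniversal, huv, hu, hv, Set.Icc_inter_Icc, h₁] using
        ⟨Or.inr (h₁.trans h₃), Or.inl (h₂.trans h₁)⟩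
    · simp [SimpleGraph.extendUniversal, huv, hu, hv]

/-- If `H₁` is obtained from `G` by adding all edges between (distinct) pairs of
vertices of `V \ S`, then `box(G) ≤ box(H₁) + box(G[V \ S])`. -/
theorem boxicity_le_boxicity_add_boxicity_induce_compl
    {V : Type*} [Fintype V] (G H₁ : SimpleGraph V) (S : Set V)
    (h : ∀ u v : V, H₁.Adj u v ↔ G.Adj u v ∨ (u ∉ S ∧ v ∉ S ∧ u ≠ v)) :
    boxicity G ≤ boxicity H₁ + boxicity (G.induce (Sᶜ : Set V)) := by
  obtain ⟨I, hI, hIadj⟩ := exists_isIntervalGraph_fin_boxicity H₁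
  obtain ⟨J, hJ, hJadj⟩ := exists_isIntervalGraph_fin_boxicity (G.induce (Sᶜ : Set V))
  have hle := boxicity_le_card G (Sum.elim I fun j => (J j).extendUniversal)
    (Sum.rec hI fun j => (hJ j).extendUniversal) fun u v => ?_
  · simpa using hle
  · simp only [Sum.forall, Sum.elim_inl, Sum.elim_inr, ← hIadj, h]
    constructor
    · exact fun huv => ⟨Or.inl huv, fun j => ⟨huv.ne, fun hu hv =>
        (hJadj ⟨u, hu⟩ ⟨v, hv⟩).1 huv j⟩⟩
    · rintro ⟨huv | ⟨hu, hv, -⟩, hj⟩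
      · exact huv
      · exact (hJadj ⟨u, hu⟩ ⟨v, hv⟩).2 fun j => (hj j).2 hu hv
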